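/- Let r2 : ℝ → ℝ³ be continuously differentiable with ‖r2' s‖ ≤ v1 for all s ∈ ℝ, where 0 ≤ v1 < 1. At any point (r1, t) ∈ G, the Jacobian determinant of the map (t, x₁, x₂, x₃) ↦ (τ, T, e₁, e₂) — i.e. the determinant of the 4×4 matrix whose rows are the partial derivatives of τ, T, e₁, e₂ with respect to t, x₁, x₂, x₃ — equals z·u²·e₃. In particular it is nonzero at every point of G where e₃ ≠ 0. -/

import Mathlib

open scoped RealInnerProductSpace

/-- Partial derivative with respect to time of a scalar field on `ℝ³ × ℝ`. -/
noncomputable def Dt (f : EuclideanSpace ℝ (Fin 3) × ℝ → ℝ)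
    (p : EuclideanSpace ℝ (Fin 3) × ℝ) : ℝ :=
  deriv (fun s : ℝ => f (p.1, s)) p.2

/-- Partial derivative with respect to the `i`-th space coordinate of a scalar
field on `ℝ³ × ℝ`. -/
noncomputable def Dx (i : Fin 3) (f : EuclideanSpace ℝ (Fin 3) × ℝ → ℝ)
    (p : EuclideanSpace ℝ (Fin 3) × ℝ) : ℝ :=
  deriv (fun h : ℝ => f (p.1 + h • EuclideanSpace.single i (1 : ℝ), p.2)) 0

/-- The norm of a real inner product space has derivative `y ↦ ⟪‖x‖⁻¹ • x, y⟫` at `x ≠ 0`. -/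
theorem hasFDerivAt_norm_of_ne_zero {E : Type*} [NormedAddCommGroup E] [InnerProductSpace ℝ E]
    {x : E} (hx : x ≠ 0) :
    HasFDerivAt (fun y : E => ‖y‖) (innerSL ℝ (‖x‖⁻¹ • x)) x := by
  have hn : ‖x‖ ≠ 0 := norm_ne_zero_iff.mpr hx
  have h := (hasStrictFDerivAt_norm_sq x).hasFDerivAt.sqrt (pow_ne_zero 2 hn)
  simp only [Real.sqrt_sq (norm_nonneg _)] at h
  refine h.congr_fderiv ?_
  ext y
  simp
  field_simp

section RetardedTime

variable {E : Type*} [NormedAddCommGroup E]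
  {r2 : ℝ → E} {v1 : ℝ} {τ : E × ℝ → ℝ}

/-- The retarded time of a trajectory of speed at most `v1 < 1` is Lipschitz. -/
theorem abs_retardedTime_sub_le (hv1 : v1 < 1)
    (hlip : ∀ s s', ‖r2 s - r2 s'‖ ≤ v1 * |s - s'|)
    (hτ : ∀ p : E × ℝ, τ p = p.2 - ‖p.1 - r2 (τ p)‖) (p q : E × ℝ) :
    |τ p - τ q| ≤ 2 / (1 - v1) * ‖p - q‖ := by
  have h1 : |p.2 - q.2| ≤ ‖p - q‖ := norm_snd_le (p - q)
  have h2 : ‖p.1 - q.1‖ ≤ ‖p - q‖ := norm_fst_le (p - q)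
  have h3 := abs_norm_sub_norm_le (q.1 - r2 (τ q)) (p.1 - r2 (τ p))
  have h4 : ‖q.1 - r2 (τ q) - (p.1 - r2 (τ p))‖ ≤ ‖p.1 - q.1‖ + ‖r2 (τ p) - r2 (τ q)‖ := by
    rw [norm_sub_rev p.1 q.1]
    refine le_trans (le_of_eq ?_) (norm_add_le _ _)
    congr 1
    abel
  have h5 := hlip (τ p) (τ q)
  have h6 : |τ p - τ q| ≤
      |p.2 - q.2| + |‖q.1 - r2 (τ q)‖ - ‖p.1 - r2 (τ p)‖| := by
    refine le_trans (le_of_eq ?_) (abs_add_le _ _)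
    congr 1
    linarith [hτ p, hτ q]
  rw [div_mul_eq_mul_div, le_div_iff₀ (by linarith)]
  linarith

/-- The retarded time is differentiable off the trajectory, with
`dτ = (1 - ⟪e, w⟫)⁻¹ (dt - ⟪e, dr⟫)`. -/
theorem hasFDerivAt_retardedTime [InnerProductSpace ℝ E] (hv1 : v1 < 1)
    (hlip : ∀ s s', ‖r2 s - r2 s'‖ ≤ v1 * |s - s'|)
    (hτ : ∀ p : E × ℝ, τ p = p.2 - ‖p.1 - r2 (τ p)‖) {p : E × ℝ} {w e : E}
    (hw : HasDerivAt r2 w (τ p)) (hp : p.1 - r2 (τ p) ≠ 0)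
    (he : e = ‖p.1 - r2 (τ p)‖⁻¹ • (p.1 - r2 (τ p))) (hne : 1 - ⟪e, w⟫ ≠ 0) :
    HasFDerivAt τ ((1 - ⟪e, w⟫)⁻¹ • (ContinuousLinearMap.snd ℝ E ℝ -
      (innerSL ℝ e).comp (ContinuousLinearMap.fst ℝ E ℝ))) p := by
  have hdiff : HasFDerivAt (fun x : (E × ℝ) × ℝ => x.1.1 - r2 x.2)
      ((ContinuousLinearMap.fst ℝ E ℝ).comp (ContinuousLinearMap.fst ℝ (E × ℝ) ℝ) -
        (ContinuousLinearMap.toSpanSingleton ℝ w).comp (ContinuousLinearMap.snd ℝ (E × ℝ) ℝ))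
      (p, τ p) :=
    (hasFDerivAt_fst.comp (p, τ p) hasFDerivAt_fst).sub
      (HasFDerivAt.comp (p, τ p) hw.hasFDerivAt hasFDerivAt_snd)
  have hnorm := HasFDerivAt.comp (p, τ p) (hasFDerivAt_norm_of_ne_zero hp) hdiff
  rw [← he] at hnorm
  have hF := (hasFDerivAt_snd.sub
    (hasFDerivAt_snd.comp (p, τ p) hasFDerivAt_fst)).add hnorm
  have hO : (fun q => τ q - τ p) =O[nhds p] fun q => q - p :=
    Asymptotics.IsBigO.of_bound (2 / (1 - v1))
      (Filter.Eventually.of_forall fun q => abs_retardedTime_sub_le hv1 hlip hτ q p)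
  have hcont : Filter.Tendsto τ (nhds p) (nhds (τ p)) := by
    refine tendsto_sub_nhds_zero_iff.mp (hO.trans_tendsto ?_)
    exact tendsto_sub_nhds_zero_iff.mpr Filter.tendsto_id
  have ho := (hF.isLittleO.comp_tendsto (Filter.tendsto_id.prodMk_nhds hcont)).trans_isBigO
    ((Asymptotics.isBigO_refl (fun q => q - p) (nhds p)).prod_left hO)
  refine .of_isLittleO ((ho.const_mul_left (-(1 - ⟪e, w⟫)⁻¹)).congr_left fun q => ?_)
  have hq := hτ q
  have hp' := hτ p
  simp [inner_sub_right]
  field_simp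
  linear_combination hp' - hq

end RetardedTime

/-- the Jacobian determinant of `(t,x₁,x₂,x₃) ↦ (τ,T,e₁,e₂)`
equals `z·u²·e₃`, hence is nonzero wherever `e₃ ≠ 0`. -/
theorem jacobian_of_fundamental_map
    (r2 : ℝ → EuclideanSpace ℝ (Fin 3)) (v1 : ℝ)
    (hv0 : 0 ≤ v1) (hv1 : v1 < 1)
    (hC1 : ContDiff ℝ 1 r2) (hbd : ∀ s : ℝ, ‖deriv r2 s‖ ≤ v1)
    (τ : EuclideanSpace ℝ (Fin 3) × ℝ → ℝ)
    (hτ : ∀ p : EuclideanSpace ℝ (Fin 3) × ℝ, τ p = p.2 - ‖p.1 - r2 (τ p)‖)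
    (T : EuclideanSpace ℝ (Fin 3) × ℝ → ℝ)
    (hT : ∀ p, T p = p.2 - τ p)
    (u : EuclideanSpace ℝ (Fin 3) × ℝ → ℝ)
    (hu : ∀ p, u p = (T p)⁻¹)
    (e : EuclideanSpace ℝ (Fin 3) × ℝ → EuclideanSpace ℝ (Fin 3))
    (he : ∀ p, e p = (T p)⁻¹ • (p.1 - r2 (τ p)))
    (v : EuclideanSpace ℝ (Fin 3) × ℝ → EuclideanSpace ℝ (Fin 3))
    (hv : ∀ p, v p = deriv r2 (τ p))
    (z : EuclideanSpace ℝ (Fin 3) × ℝ → ℝ)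
    (hz : ∀ p, z p = (1 - ⟪e p, v p⟫)⁻¹)
    (r1 : EuclideanSpace ℝ (Fin 3)) (t : ℝ)
    (hG : 0 < T (r1, t))
    (M : Matrix (Fin 4) (Fin 4) ℝ)
    (hM : M =
      !![Dt τ (r1, t), Dx 0 τ (r1, t), Dx 1 τ (r1, t), Dx 2 τ (r1, t);
         Dt T (r1, t), Dx 0 T (r1, t), Dx 1 T (r1, t), Dx 2 T (r1, t);
         Dt (fun p => e p 0) (r1, t), Dx 0 (fun p => e p 0) (r1, t),
           Dx 1 (fun p => e p 0) (r1, t), Dx 2 (fun p => e p 0) (r1, t);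
         Dt (fun p => e p 1) (r1, t), Dx 0 (fun p => e p 1) (r1, t),
           Dx 1 (fun p => e p 1) (r1, t), Dx 2 (fun p => e p 1) (r1, t)]) :
    M.det = z (r1, t) * u (r1, t) ^ 2 * e (r1, t) 2 ∧
      (e (r1, t) 2 ≠ 0 → M.det ≠ 0) := by
  have hlip : ∀ s s', ‖r2 s - r2 s'‖ ≤ v1 * |s - s'| := fun s s' =>
    Convex.norm_image_sub_le_of_norm_deriv_le
      (fun x _ => hC1.differentiable (by norm_num) x) (fun x _ => hbd x) convex_univ
      (Set.mem_univ s') (Set.mem_univ s)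
  have hTn : ∀ p, T p = ‖p.1 - r2 (τ p)‖ := fun p => by linarith [hT p, hτ p]
  have hT0 : T (r1, t) ≠ 0 := hG.ne'
  have hr0 : r1 - r2 (τ (r1, t)) ≠ 0 := by
    rw [← norm_ne_zero_iff]
    exact hTn (r1, t) ▸ hT0
  have hw : HasDerivAt r2 (v (r1, t)) (τ (r1, t)) := by
    rw [hv]
    exact (hC1.differentiable (by norm_num) _).hasDerivAt
  have he' : e (r1, t) = ‖r1 - r2 (τ (r1, t))‖⁻¹ • (r1 - r2 (τ (r1, t))) := by
    rw [he, hTn]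
  have hne : 1 - ⟪e (r1, t), v (r1, t)⟫ ≠ 0 := by
    have h1 := real_inner_le_norm (e (r1, t)) (v (r1, t))
    have h2 : ‖e (r1, t)‖ = 1 := by
      rw [he', norm_smul, norm_inv, norm_norm, inv_mul_cancel₀ (norm_ne_zero_iff.mpr hr0)]
    have h3 : ‖v (r1, t)‖ ≤ v1 := hv (r1, t) ▸ hbd _
    rw [h2, one_mul] at h1
    linarith
  have hD := hasFDerivAt_retardedTime hv1 hlip hτ hw hr0 he' hne
  rw [← hz] at hD
  have hτγ : ∀ (γ : ℝ → EuclideanSpace ℝ (Fin 3) × ℝ) q s, γ s = (r1, t) → HasDerivAt γ q s →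
      HasDerivAt (fun x => τ (γ x)) (z (r1, t) * (q.2 - ⟪e (r1, t), q.1⟫)) s := by
    intro γ q s hs hγ
    rw [← hs] at hD
    refine (hD.comp_hasDerivAt s hγ).congr_deriv ?_
    simp [hs]
  have hTγ : ∀ (γ : ℝ → EuclideanSpace ℝ (Fin 3) × ℝ) q s, γ s = (r1, t) → HasDerivAt γ q s →
      HasDerivAt (fun x => T (γ x)) (q.2 - z (r1, t) * (q.2 - ⟪e (r1, t), q.1⟫)) s := by
    intro γ q s hs hγ
    simp only [hT]
    exact (hasFDerivAt_snd.comp_hasDerivAt s hγ).sub (hτγ γ q s hs hγ)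
  have heγ : ∀ (γ : ℝ → EuclideanSpace ℝ (Fin 3) × ℝ) q s, γ s = (r1, t) → HasDerivAt γ q s →
      ∀ i, HasDerivAt (fun x => e (γ x) i)
        (u (r1, t) * (q.1 i - z (r1, t) * (q.2 - ⟪e (r1, t), q.1⟫) * v (r1, t) i -
          e (r1, t) i * (q.2 - z (r1, t) * (q.2 - ⟪e (r1, t), q.1⟫)))) s := by
    intro γ q s hs hγ i
    have hwγ : HasDerivAt r2 (v (r1, t)) (τ (γ s)) := by rwa [hs]
    have h1 := (hasFDerivAt_fst.comp_hasDerivAt s hγ).sub (hwγ.scomp s (hτγ γ q s hs hγ))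
    have h2 := (hTγ γ q s hs hγ).fun_inv (by rwa [hs])
    have h3 := (EuclideanSpace.proj (𝕜 := ℝ) i).hasFDerivAt.comp_hasDerivAt s (h2.smul h1)
    have h4 : (fun x => e (γ x) i) = fun x => (EuclideanSpace.proj (𝕜 := ℝ) i)
        ((T (γ x))⁻¹ • ((γ x).1 - r2 (τ (γ x)))) := by
      funext x
      rw [he]
      rfl
    rw [h4]
    refine h3.congr_deriv ?_
    simp [hs, hu, he]
    field_simp
    ring
  have ht : HasDerivAt (fun s : ℝ => (r1, s)) ((0 : EuclideanSpace ℝ (Fin 3)), (1 : ℝ)) t :=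
    (hasDerivAt_const t r1).prodMk (hasDerivAt_id t)
  have hx : ∀ i : Fin 3, HasDerivAt
      (fun h : ℝ => (r1 + h • EuclideanSpace.single i (1 : ℝ), t))
      (EuclideanSpace.single i (1 : ℝ), (0 : ℝ)) 0 := fun i =>
    (((hasDerivAt_id (0 : ℝ)).smul_const _).const_add r1 |>.congr_deriv (one_smul ℝ _)).prodMk
      (hasDerivAt_const _ t)
  have hx0 : ∀ i : Fin 3, (r1 + (0 : ℝ) • EuclideanSpace.single i (1 : ℝ), t) = (r1, t) :=
    fun i => by simp
  have hdet : M.det = z (r1, t) * u (r1, t) ^ 2 * e (r1, t) 2 := by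
    have h1 : Dt τ (r1, t) = _ := (hτγ _ _ t rfl ht).deriv
    have h2 : ∀ i, Dx i τ (r1, t) = _ := fun i => (hτγ _ _ 0 (hx0 i) (hx i)).deriv
    have h3 : Dt T (r1, t) = _ := (hTγ _ _ t rfl ht).deriv
    have h4 : ∀ i, Dx i T (r1, t) = _ := fun i => (hTγ _ _ 0 (hx0 i) (hx i)).deriv
    have h5 : ∀ j, Dt (fun p => e p j) (r1, t) = _ := fun j => (heγ _ _ t rfl ht j).deriv
    have h6 : ∀ i j, Dx i (fun p => e p j) (r1, t) = _ := fun i j =>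
      (heγ _ _ 0 (hx0 i) (hx i) j).deriv
    rw [hM, h1, h3, h2, h2, h2, h4, h4, h4, h5, h5, h6, h6, h6, h6, h6, h6]
    simp [Matrix.det_succ_row_zero, Fin.sum_univ_succ, Fin.succAbove,
      EuclideanSpace.inner_single_right]
    ring
  refine ⟨hdet, fun h => ?_⟩
  rw [hdet, hz, hu]
  exact mul_ne_zero (mul_ne_zero (inv_ne_zero hne) (pow_ne_zero 2 (inv_ne_zero hT0))) h
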